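/- Let n ≥ 1 and let Q be a real orthogonal n×n matrix with first column q_0 = (1/√n)·𝟏. Define M(Q) := n·max_{1≤j≤n−1} ‖q_j‖_∞². If (λ_0, λ_1, …, λ_{n−1}) is a real list with λ_0 = 1, λ_j ≤ 0 for 1 ≤ j ≤ n−1, and 1 + ∑_{j=1}^{n−1} λ_j > 1 − 1/M(Q), then Q Λ Qᵀ with Λ = diag(λ_0,…,λ_{n−1}) is symmetric and doubly stochastic. -/

import Mathlib

open Real Matrix Finset

/-- Coherence of an `n×n` real matrix: `M(Q) = n · max_{1≤j≤n−1} ‖q_j‖_∞²`,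
where `q_j` is the `j`-th column of `Q` and `‖·‖` is the sup norm on `ℝⁿ`. -/
noncomputable def coherence (n : ℕ) (Q : Matrix (Fin n) (Fin n) ℝ) : ℝ :=
  (n : ℝ) * sSup {x : ℝ | ∃ j : Fin n, (j : ℕ) ≠ 0 ∧ x = ‖(fun k : Fin n => Q k j)‖ ^ 2}

theorem mul_diagonal_mul_transpose_apply {n : ℕ} (Q : Matrix (Fin n) (Fin n) ℝ)
    (lam : Fin n → ℝ) (k l : Fin n) :
    (Q * Matrix.diagonal lam * Qᵀ) k l = ∑ j, lam j * (Q k j * Q l j) := by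
  rw [Matrix.mul_apply]
  refine Finset.sum_congr rfl fun j _ => ?_
  rw [Matrix.mul_diagonal, Matrix.transpose_apply]
  ring

theorem mul_le_sSup_sq_norm_col {n : ℕ} (Q : Matrix (Fin n) (Fin n) ℝ) (k l j : Fin n)
    (hj : (j : ℕ) ≠ 0) :
    Q k j * Q l j ≤
      sSup {x : ℝ | ∃ j : Fin n, (j : ℕ) ≠ 0 ∧ x = ‖(fun k : Fin n => Q k j)‖ ^ 2} := by
  have hbdd : BddAbove
      {x : ℝ | ∃ j : Fin n, (j : ℕ) ≠ 0 ∧ x = ‖(fun k : Fin n => Q k j)‖ ^ 2} := by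
    refine ((Set.finite_range fun j : Fin n => ‖(fun k : Fin n => Q k j)‖ ^ 2).subset ?_).bddAbove
    rintro x ⟨j, -, rfl⟩
    exact ⟨j, rfl⟩
  refine le_trans ?_ (le_csSup hbdd ⟨j, hj, rfl⟩)
  have hnorm (i : Fin n) : |Q i j| ≤ ‖(fun k : Fin n => Q k j)‖ :=
    norm_le_pi_norm (fun k : Fin n => Q k j) i
  calc Q k j * Q l j ≤ |Q k j| * |Q l j| := by rw [← abs_mul]; exact le_abs_self _
    _ ≤ ‖(fun k : Fin n => Q k j)‖ * ‖(fun k : Fin n => Q k j)‖ :=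
        mul_le_mul (hnorm k) (hnorm l) (abs_nonneg _) (norm_nonneg _)
    _ = _ := (sq _).symm

theorem stmt16 (n : ℕ) (hn : 1 ≤ n) (Q : Matrix (Fin n) (Fin n) ℝ)
    (horth : Qᵀ * Q = 1)
    (hcol0 : ∀ k j : Fin n, (j : ℕ) = 0 → Q k j = 1 / Real.sqrt n)
    (lam : Fin n → ℝ)
    (h0 : ∀ j : Fin n, (j : ℕ) = 0 → lam j = 1)
    (hneg : ∀ j : Fin n, (j : ℕ) ≠ 0 → lam j ≤ 0)
    (hsum : 1 + ∑ j ∈ Finset.univ.filter (fun j : Fin n => (j : ℕ) ≠ 0), lam j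
      > 1 - 1 / coherence n Q) :
    (Q * Matrix.diagonal lam * Qᵀ)ᵀ = Q * Matrix.diagonal lam * Qᵀ ∧
      (∀ k l : Fin n, 0 ≤ (Q * Matrix.diagonal lam * Qᵀ) k l) ∧
      (∀ k : Fin n, ∑ l : Fin n, (Q * Matrix.diagonal lam * Qᵀ) k l = 1) ∧
      (∀ l : Fin n, ∑ k : Fin n, (Q * Matrix.diagonal lam * Qᵀ) k l = 1) := by
  have hsymm : (Q * Matrix.diagonal lam * Qᵀ)ᵀ = Q * Matrix.diagonal lam * Qᵀ := by
    simp [Matrix.transpose_mul, Matrix.mul_assoc]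
  have hn0 : (0 : ℝ) < n := by exact_mod_cast hn
  have hsq : (0 : ℝ) < Real.sqrt n := Real.sqrt_pos.2 hn0
  let z : Fin n := ⟨0, hn⟩
  have hz (j : Fin n) : (j : ℕ) ≠ 0 ↔ j ≠ z := by simp [z, Fin.ext_iff]
  have hfilter : Finset.univ.filter (fun j : Fin n => (j : ℕ) ≠ 0) = Finset.univ.erase z := by
    ext j
    simp [hz]
  have hcolsum (j : Fin n) : ∑ l, Q l j = if z = j then Real.sqrt n else 0 := by
    have h := congrFun (congrFun horth z) j
    simp only [Matrix.mul_apply, Matrix.transpose_apply, hcol0 _ z rfl, ← Finset.mul_sum,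
      Matrix.one_apply] at h
    split_ifs at h ⊢ <;> field_simp at h <;> simpa using h
  have hrow (k : Fin n) : ∑ l, (Q * Matrix.diagonal lam * Qᵀ) k l = 1 := by
    simp only [mul_diagonal_mul_transpose_apply]
    rw [Finset.sum_comm]
    simp only [← Finset.mul_sum, hcolsum, mul_ite, mul_zero, Finset.sum_ite_eq, Finset.mem_univ, if_true]
    rw [h0 z rfl, hcol0 k z rfl]
    field_simp
  refine ⟨hsymm, fun k l => ?_, hrow, fun l => ?_⟩
  · rw [mul_diagonal_mul_transpose_apply, ← Finset.add_sum_erase _ _ (Finset.mem_univ z),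
      h0 z rfl, hcol0 k z rfl, hcol0 l z rfl]
    rw [hfilter, coherence] at hsum
    have hle := mul_le_sSup_sq_norm_col Q
    have hS0 : 0 ≤ sSup {x : ℝ | ∃ j : Fin n,
        (j : ℕ) ≠ 0 ∧ x = ‖(fun k : Fin n => Q k j)‖ ^ 2} := by
      apply Real.sSup_nonneg
      rintro x ⟨j, -, rfl⟩
      positivity
    generalize sSup {x : ℝ | ∃ j : Fin n,
      (j : ℕ) ≠ 0 ∧ x = ‖(fun k : Fin n => Q k j)‖ ^ 2} = S at hsum hle hS0
    have hterm : (∑ j ∈ Finset.univ.erase z, lam j) * S ≤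
        ∑ j ∈ Finset.univ.erase z, lam j * (Q k j * Q l j) := by
      rw [Finset.sum_mul]
      refine Finset.sum_le_sum fun j hj => ?_
      have hj' := (hz j).2 (Finset.ne_of_mem_erase hj)
      exact mul_le_mul_of_nonpos_left (hle k l j hj') (hneg j hj')
    have hlam : ∑ j ∈ Finset.univ.erase z, lam j ≤ 0 :=
      Finset.sum_nonpos fun j hj => hneg j ((hz j).2 (Finset.ne_of_mem_erase hj))
    have hS : 0 < S := by
      refine hS0.lt_of_ne fun h => ?_
      rw [← h, mul_zero, div_zero] at hsum
      linarith
    have hmul : -(1 / (n * S)) * S ≤ (∑ j ∈ Finset.univ.erase z, lam j) * S :=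
      mul_le_mul_of_nonneg_right (by linarith) hS0
    have hcancel : -(1 / (n * S)) * S = -(1 / n) := by field_simp
    have hfirst : 1 * (1 / Real.sqrt n * (1 / Real.sqrt n)) = 1 / (n : ℝ) := by
      rw [one_mul, div_mul_div_comm, Real.mul_self_sqrt hn0.le, one_mul]
    linarith
  · rw [← hrow l]
    exact Finset.sum_congr rfl fun k _ => congrFun (congrFun hsymm l) k
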